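/- Let r be a standard Gaussian random vector in ℝᶜ and v₁, v₂ ∈ ℝᶜ nonzero vectors. Then P(sign(rᵀv₁) = sign(rᵀv₂)) = 1 − θ/π, where θ ∈ [0, π] is the angle between v₁ and v₂. -/

import Mathlib

open MeasureTheory ProbabilityTheory Real RealInnerProductSpace

noncomputable def rsign (x : ℝ) : ℝ := if 0 ≤ x then 1 else -1

lemma charFunDual_map_inner_prodMk_stdGaussian {E : Type*}
    [NormedAddCommGroup E] [InnerProductSpace ℝ E] [FiniteDimensional ℝ E]
    [MeasurableSpace E] [BorelSpace E] (v₁ v₂ : E) (L : StrongDual ℝ (ℝ × ℝ)) :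
    charFunDual ((stdGaussian E).map ((innerSL ℝ v₁).prod (innerSL ℝ v₂))) L =
      Complex.exp (-((‖L (1, 0) • v₁ + L (0, 1) • v₂‖ : ℝ) : ℂ) ^ 2 / 2) := by
  have hL : L.comp ((innerSL ℝ v₁).prod (innerSL ℝ v₂)) =
      innerSL ℝ (L (1, 0) • v₁ + L (0, 1) • v₂) := by
    ext x
    have : ((⟪v₁, x⟫, ⟪v₂, x⟫) : ℝ × ℝ) =
        ⟪v₁, x⟫ • ((1, 0) : ℝ × ℝ) + ⟪v₂, x⟫ • ((0, 1) : ℝ × ℝ) := by simp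
    change L (⟪v₁, x⟫, ⟪v₂, x⟫) = ⟪L (1, 0) • v₁ + L (0, 1) • v₂, x⟫
    rw [this, map_add, map_smul, map_smul, inner_add_left, real_inner_smul_left,
      real_inner_smul_left, smul_eq_mul, smul_eq_mul]
    ring
  rw [charFunDual_map, charFunDual_stdGaussian, hL, innerSL_apply_norm]

lemma map_inner_prodMk_stdGaussian_eq_of_gram_eq {E F : Type*}
    [NormedAddCommGroup E] [InnerProductSpace ℝ E] [FiniteDimensional ℝ E]
    [MeasurableSpace E] [BorelSpace E]
    [NormedAddCommGroup F] [InnerProductSpace ℝ F] [FiniteDimensional ℝ F]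
    [MeasurableSpace F] [BorelSpace F]
    {v₁ v₂ : E} {w₁ w₂ : F} (h₁ : ‖v₁‖ = ‖w₁‖) (h₂ : ‖v₂‖ = ‖w₂‖)
    (h : ⟪v₁, v₂⟫ = ⟪w₁, w₂⟫) :
    (stdGaussian E).map (fun x ↦ (⟪v₁, x⟫, ⟪v₂, x⟫)) =
      (stdGaussian F).map (fun x ↦ (⟪w₁, x⟫, ⟪w₂, x⟫)) := by
  have hnorm (a b : ℝ) : ‖a • v₁ + b • v₂‖ ^ 2 = ‖a • w₁ + b • w₂‖ ^ 2 := by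
    simp only [norm_add_sq_real, norm_smul, real_inner_smul_left, real_inner_smul_right,
      h₁, h₂, h]
  change (stdGaussian E).map ((innerSL ℝ v₁).prod (innerSL ℝ v₂)) =
    (stdGaussian F).map ((innerSL ℝ w₁).prod (innerSL ℝ w₂))
  have : IsProbabilityMeasure ((stdGaussian E).map ((innerSL ℝ v₁).prod (innerSL ℝ v₂))) :=
    Measure.isProbabilityMeasure_map (by fun_prop)
  have : IsProbabilityMeasure ((stdGaussian F).map ((innerSL ℝ w₁).prod (innerSL ℝ w₂))) :=
    Measure.isProbabilityMeasure_map (by fun_prop)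
  apply Measure.ext_of_charFunDual
  ext L
  rw [charFunDual_map_inner_prodMk_stdGaussian, charFunDual_map_inner_prodMk_stdGaussian,
    ← Complex.ofReal_pow, ← Complex.ofReal_pow, hnorm]

lemma gaussianPDF_mul_cos_mul_gaussianPDF_mul_sin (ρ φ : ℝ) :
    gaussianPDF 0 1 (ρ * cos φ) * gaussianPDF 0 1 (ρ * sin φ) =
      gaussianPDF 0 1 ρ * gaussianPDF 0 1 0 := by
  simp only [gaussianPDF, ← ENNReal.ofReal_mul (gaussianPDFReal_nonneg _ _ _)]
  congr 1
  simp only [gaussianPDFReal, mul_mul_mul_comm _ (rexp _), ← Real.exp_add]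
  congr 2
  simp only [sub_zero, NNReal.coe_one]
  linear_combination (-ρ ^ 2 / 2) * Real.sin_sq_add_cos_sq φ

lemma gaussianReal_prod_cone_eq_const_mul {S : Set (ℝ × ℝ)} (hS : MeasurableSet S)
    (hcone : ∀ ρ : ℝ, 0 < ρ → ∀ x y : ℝ, (ρ * x, ρ * y) ∈ S ↔ (x, y) ∈ S) :
    ((gaussianReal 0 1).prod (gaussianReal 0 1)) S =
      (∫⁻ ρ in Set.Ioi (0 : ℝ), ENNReal.ofReal ρ * (gaussianPDF 0 1 ρ * gaussianPDF 0 1 0)) *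
        volume ({φ : ℝ | (cos φ, sin φ) ∈ S} ∩ Set.Ioo (-π) π) := by
  have hT : MeasurableSet {φ : ℝ | (cos φ, sin φ) ∈ S} :=
    hS.preimage (by fun_prop : Measurable fun φ : ℝ ↦ (cos φ, sin φ))
  have hpdf := measurable_gaussianPDF 0 1
  rw [gaussianReal_of_var_ne_zero 0 one_ne_zero, prod_withDensity hpdf hpdf,
    withDensity_apply _ hS, ← lintegral_indicator hS, ← Measure.volume_eq_prod,
    ← lintegral_comp_polarCoord_symm, polarCoord_target, Measure.volume_eq_prod,
    ← Measure.prod_restrict, ← Measure.restrict_apply hT, ← lintegral_indicator_one hT,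
    ← lintegral_prod_mul (by fun_prop) (by fun_prop (disch := exact hT)), Measure.prod_restrict]
  refine setLIntegral_congr_fun (measurableSet_Ioi.prod measurableSet_Ioo) ?_
  rintro ⟨ρ, φ⟩ ⟨hρ, -⟩
  have hmem := hcone ρ hρ (cos φ) (sin φ)
  by_cases hφ : (cos φ, sin φ) ∈ S
  · simp [hmem, hφ, gaussianPDF_mul_cos_mul_gaussianPDF_mul_sin]
  · simp [hmem, hφ]

lemma gaussianReal_prod_cone {S : Set (ℝ × ℝ)} (hS : MeasurableSet S)
    (hcone : ∀ ρ : ℝ, 0 < ρ → ∀ x y : ℝ, (ρ * x, ρ * y) ∈ S ↔ (x, y) ∈ S) :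
    ((gaussianReal 0 1).prod (gaussianReal 0 1)) S =
      volume ({φ : ℝ | (cos φ, sin φ) ∈ S} ∩ Set.Ioo (-π) π) / ENNReal.ofReal (2 * π) := by
  have huniv := gaussianReal_prod_cone_eq_const_mul MeasurableSet.univ (by simp)
  rw [measure_univ] at huniv
  simp only [Set.mem_univ, Set.ofPred_true, Set.univ_inter, Real.volume_Ioo,
    sub_neg_eq_add, ← two_mul] at huniv
  rw [gaussianReal_prod_cone_eq_const_mul hS hcone, ENNReal.eq_inv_of_mul_eq_one_left huniv.symm,
    mul_comm, ENNReal.div_eq_inv_mul, mul_comm]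

lemma rsign_mul_of_pos {a : ℝ} (ha : 0 < a) (x : ℝ) : rsign (a * x) = rsign x := by
  simp [rsign, mul_nonneg_iff_of_pos_left ha]

lemma rsign_eq_rsign_iff (x y : ℝ) : rsign x = rsign y ↔ (0 ≤ x ↔ 0 ≤ y) := by
  by_cases hx : 0 ≤ x <;> by_cases hy : 0 ≤ y <;> simp only [rsign, hx, hy] <;> norm_num

lemma measurable_rsign : Measurable rsign :=
  Measurable.ite measurableSet_Ici measurable_const measurable_const

lemma volume_rsign_sin_eq_rsign_sin_sub {θ : ℝ} (h0 : 0 ≤ θ) (hπ : θ ≤ π) :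
    volume ({φ : ℝ | rsign (sin φ) = rsign (sin (φ - θ))} ∩ Set.Ioo (-π) π) =
      ENNReal.ofReal (2 * (π - θ)) := by
  have hae : ({φ : ℝ | rsign (sin φ) = rsign (sin (φ - θ))} ∩ Set.Ioo (-π) π : Set ℝ) =ᵐ[volume]
      (Set.Ico θ π ∪ Set.Ioo (θ - π) 0 : Set ℝ) := by
    rw [Filter.eventuallyEq_set]
    filter_upwards [Measure.ae_ne volume (0 : ℝ)] with φ hφ
    simp only [Set.mem_inter_iff, Set.mem_ofPred_eq, Set.mem_union, Set.mem_Ioo, Set.mem_Ico,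
      rsign_eq_rsign_iff]
    constructor
    · rintro ⟨hsign, hl, hr⟩
      rcases hφ.lt_or_gt with hneg | hpos
      · refine Or.inr ⟨?_, hneg⟩
        by_contra! hle
        have h1 := sin_neg_of_neg_of_neg_pi_lt hneg hl
        have h2 : 0 ≤ sin (φ - θ) := by
          rw [← sin_add_two_pi]
          exact sin_nonneg_of_nonneg_of_le_pi (by linarith) (by linarith)
        exact h1.not_ge (hsign.2 h2)
      · refine Or.inl ⟨?_, hr⟩
        by_contra! hlt
        have h1 := sin_nonneg_of_nonneg_of_le_pi hpos.le hr.le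
        have h2 := sin_neg_of_neg_of_neg_pi_lt (x := φ - θ) (by linarith) (by linarith)
        exact h2.not_ge (hsign.1 h1)
    · rintro (⟨hl, hr⟩ | ⟨hl, hr⟩)
      · have h1 := sin_nonneg_of_nonneg_of_le_pi (h0.trans hl) hr.le
        have h2 := sin_nonneg_of_nonneg_of_le_pi (x := φ - θ) (by linarith) (by linarith)
        exact ⟨iff_of_true h1 h2, by linarith, hr⟩
      · have h1 := sin_neg_of_neg_of_neg_pi_lt hr (by linarith)
        have h2 := sin_neg_of_neg_of_neg_pi_lt (x := φ - θ) (by linarith) (by linarith)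
        exact ⟨iff_of_false h1.not_ge h2.not_ge, by linarith, by linarith⟩
  have hdisj : Disjoint (Set.Ico θ π) (Set.Ioo (θ - π) 0) :=
    Set.disjoint_left.2 fun φ h h' ↦ (h0.trans h.1).not_gt h'.2
  rw [measure_congr hae, measure_union hdisj measurableSet_Ioo, Real.volume_Ico, Real.volume_Ioo,
    ← ENNReal.ofReal_add (by linarith) (by linarith)]
  congr 1
  ring

lemma gaussianReal_prod_rsign_eq {θ : ℝ} (h0 : 0 ≤ θ) (hπ : θ ≤ π) :
    ((gaussianReal 0 1).prod (gaussianReal 0 1))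
      {p : ℝ × ℝ | rsign p.2 = rsign (p.2 * cos θ - p.1 * sin θ)} =
      ENNReal.ofReal (1 - θ / π) := by
  rw [gaussianReal_prod_cone]
  · simp only [Set.mem_ofPred_eq, ← sin_sub]
    rw [volume_rsign_sin_eq_rsign_sin_sub h0 hπ, ← ENNReal.ofReal_div_of_pos (by positivity)]
    congr 1
    field_simp
  · exact measurableSet_eq_fun (measurable_rsign.comp (by fun_prop))
      (measurable_rsign.comp (by fun_prop))
  · intro ρ hρ x y
    have : ρ * y * cos θ - ρ * x * sin θ = ρ * (y * cos θ - x * sin θ) := by ring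
    simp only [Set.mem_ofPred_eq, this, rsign_mul_of_pos hρ]

lemma stdGaussian_rsign_inner_eq {E : Type*}
    [NormedAddCommGroup E] [InnerProductSpace ℝ E] [FiniteDimensional ℝ E]
    [MeasurableSpace E] [BorelSpace E] {v₁ v₂ : E} (hv₁ : v₁ ≠ 0) (hv₂ : v₂ ≠ 0) :
    stdGaussian E {x | rsign ⟪v₁, x⟫ = rsign ⟪v₂, x⟫} =
      ENNReal.ofReal (1 - InnerProductGeometry.angle v₁ v₂ / π) := by
  set θ := InnerProductGeometry.angle v₁ v₂ with hθ
  set e₁ : EuclideanSpace ℝ (Fin 2) := !₂[0, 1] with he₁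
  set e₂ : EuclideanSpace ℝ (Fin 2) := !₂[-sin θ, cos θ] with he₂
  have hn₁ : ‖e₁‖ = 1 := by simp [he₁, EuclideanSpace.norm_eq]
  have hn₂ : ‖e₂‖ = 1 := by simp [he₂, EuclideanSpace.norm_eq]
  have hinner : ⟪e₁, e₂⟫ = cos θ := by simp [he₁, he₂, PiLp.inner_apply]
  have hmap := map_inner_prodMk_stdGaussian_eq_of_gram_eq
    (v₁ := v₁) (v₂ := v₂) (w₁ := ‖v₁‖ • e₁) (w₂ := ‖v₂‖ • e₂)
    (by simp [norm_smul, hn₁]) (by simp [norm_smul, hn₂])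
    (by rw [real_inner_smul_left, real_inner_smul_right, hinner, hθ,
      ← InnerProductGeometry.cos_angle_mul_norm_mul_norm]; ring)
  have hA : MeasurableSet {p : ℝ × ℝ | rsign p.1 = rsign p.2} :=
    measurableSet_eq_fun (measurable_rsign.comp measurable_fst)
      (measurable_rsign.comp measurable_snd)
  have hB : MeasurableSet {p : ℝ × ℝ | rsign p.2 = rsign (p.2 * cos θ - p.1 * sin θ)} :=
    measurableSet_eq_fun (measurable_rsign.comp (by fun_prop))
      (measurable_rsign.comp (by fun_prop))
  have hmapA := congrArg (fun μ ↦ μ {p : ℝ × ℝ | rsign p.1 = rsign p.2}) hmap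
  simp only at hmapA
  rw [Measure.map_apply (by fun_prop) hA, Measure.map_apply (by fun_prop) hA] at hmapA
  refine hmapA.trans ?_
  have hpre := hA.preimage (by fun_prop :
    Measurable fun x : EuclideanSpace ℝ (Fin 2) ↦ (⟪‖v₁‖ • e₁, x⟫, ⟪‖v₂‖ • e₂, x⟫))
  rw [← map_pi_eq_stdGaussian, Measure.map_apply (by fun_prop) hpre,
    ← gaussianReal_prod_rsign_eq (InnerProductGeometry.angle_nonneg v₁ v₂)
      (InnerProductGeometry.angle_le_pi v₁ v₂),
    ← (measurePreserving_finTwoArrow (gaussianReal 0 1)).measure_preimage hB.nullMeasurableSet]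
  congr 1
  ext x
  simp only [Set.mem_preimage, Set.mem_ofPred_eq, real_inner_smul_left,
    rsign_mul_of_pos (norm_pos_iff.2 hv₁), rsign_mul_of_pos (norm_pos_iff.2 hv₂)]
  simp [he₁, he₂, PiLp.inner_apply, MeasurableEquiv.finTwoArrow, sub_eq_neg_add]

theorem hyperplane_rounding
    (c : ℕ) (Ω : Type*) [MeasureSpace Ω] [IsProbabilityMeasure (ℙ : Measure Ω)]
    (r : Ω → Fin c → ℝ) (hmeas : Measurable r)
    (hlaw : Measure.map r ℙ = Measure.pi fun _ : Fin c => gaussianReal 0 1)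
    (v₁ v₂ : EuclideanSpace ℝ (Fin c)) (hv₁ : v₁ ≠ 0) (hv₂ : v₂ ≠ 0) :
    ℙ {ω | rsign (∑ i, r ω i * v₁ i) = rsign (∑ i, r ω i * v₂ i)} =
      ENNReal.ofReal (1 - Real.arccos (⟪v₁, v₂⟫ / (‖v₁‖ * ‖v₂‖)) / π) := by
  have hA : MeasurableSet {x : EuclideanSpace ℝ (Fin c) | rsign ⟪v₁, x⟫ = rsign ⟪v₂, x⟫} :=
    measurableSet_eq_fun (measurable_rsign.comp (by fun_prop))
      (measurable_rsign.comp (by fun_prop))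
  refine Eq.trans ?_ (stdGaussian_rsign_inner_eq hv₁ hv₂)
  rw [← map_pi_eq_stdGaussian, ← hlaw, Measure.map_map (by fun_prop) hmeas,
    Measure.map_apply (by fun_prop) hA]
  simp [PiLp.inner_apply]
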